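/- arXiv:math/0202069 — 2 statements merged into one kernel-verified Lean document; each statement's English description precedes it below -/
import Mathlib

section
/- The multiplicity along the conic C = {x0 = 0, 4*x3*x1 - 3*x2^2 = 0} of the form x1*D^3 + x0^5*D^2 equals 3; i.e., the form lies in the ideal (x0, 4*x3*x1 - 3*x2^2)^3 but not in (x0, 4*x3*x1 - 3*x2^2)^4 (localizing at the generic point of C). -/
open MvPolynomial in
/-- Setting the variable `X i` to zero changes a polynomial by a multiple of `X i`. -/
theorem MvPolynomial.X_dvd_sub_aeval_update_zero {σ R : Type*} [DecidableEq σ] [CommRing R]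
    (i : σ) (p : MvPolynomial σ R) :
    (X i : MvPolynomial σ R) ∣ p - aeval (Function.update X i 0) p := by
  rw [← Ideal.mem_span_singleton, ← Ideal.Quotient.mk_eq_mk_iff_sub_mem]
  have h : (Ideal.Quotient.mkₐ R (Ideal.span {(X i : MvPolynomial σ R)})) =
      (Ideal.Quotient.mkₐ R (Ideal.span {(X i : MvPolynomial σ R)})).comp
        (aeval (Function.update X i 0)) := by
    ext j
    by_cases hj : j = i
    · subst hj
      simp
    · simp [Function.update_of_ne hj]
  exact DFunLike.congr_fun h p

open MvPolynomial in
/-- The multiplicity along the conic `C = {x0 = 0, 4*x3*x1 - 3*x2^2 = 0}` of the form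
`x1*D^3 + x0^5*D^2` is `3`: it lies in the third symbolic power of the prime ideal
`P = (x0, 4*x3*x1 - 3*x2^2)` but not in the fourth (membership in the `m`-th symbolic
power meaning `s * f ∈ P^m` for some `s ∉ P`). -/
theorem multiplicity_along_conic {k : Type*} [Field k] [CharZero k] :
    let D : MvPolynomial (Fin 4) k :=
      X 0 ^ 2 * X 3 ^ 2 - 3 * X 1 ^ 2 * X 2 ^ 2 - 6 * X 0 * X 1 * X 2 * X 3 +
        4 * X 0 * X 2 ^ 3 + 4 * X 3 * X 1 ^ 3
    let P : Ideal (MvPolynomial (Fin 4) k) := Ideal.span {X 0, 4 * X 3 * X 1 - 3 * X 2 ^ 2}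
    let f : MvPolynomial (Fin 4) k := X 1 * D ^ 3 + X 0 ^ 5 * D ^ 2
    (∃ s ∉ P, s * f ∈ P ^ 3) ∧ ¬ ∃ s ∉ P, s * f ∈ P ^ 4 := by
  intro D P f
  set q : MvPolynomial (Fin 4) k := 4 * X 3 * X 1 - 3 * X 2 ^ 2 with hq
  have hX0 : X 0 ∈ P := Ideal.subset_span (by simp)
  have hqP : q ∈ P := Ideal.subset_span (by simp [hq])
  have hD : D = X 1 ^ 2 * q + (X 0 * X 3 ^ 2 - 6 * X 1 * X 2 * X 3 + 4 * X 2 ^ 3) * X 0 := by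
    simp only [D, hq]; ring
  refine ⟨⟨1, fun h1 => ?_, ?_⟩, ?_⟩
  · have hle : P ≤ RingHom.ker (constantCoeff : MvPolynomial (Fin 4) k →+* k) := by
      rw [Ideal.span_le]
      rintro _ (rfl | rfl) <;> simp [RingHom.mem_ker]
    simpa [RingHom.mem_ker] using hle h1
  · have hDP : D ∈ P := hD ▸ add_mem (P.mul_mem_left _ hqP) (P.mul_mem_left _ hX0)
    rw [one_mul]
    refine add_mem (Ideal.mul_mem_left _ _ (Ideal.pow_mem_pow hDP 3)) ?_
    have h := Ideal.mul_mem_mul (Ideal.pow_mem_pow hX0 5) (Ideal.pow_mem_pow hDP 2)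
    rw [← pow_add] at h
    exact Ideal.pow_le_pow_right (by norm_num) h
  · rintro ⟨s, hs, hsf⟩
    apply hs
    let φ : MvPolynomial (Fin 4) k →ₐ[k] MvPolynomial (Fin 4) k :=
      aeval (Function.update X 0 0)
    have h0 : φ (X 0) = 0 := by simp [φ]
    have h1 : φ (X 1) = X 1 := by simp [φ]
    have h2 : φ (X 2) = X 2 := by simp [φ]
    have h3 : φ (X 3) = X 3 := by simp [φ]
    have hφq : φ q = q := by simp only [hq, map_sub, map_mul, map_pow, map_ofNat, h1, h2, h3]
    have hφf : φ f = q ^ 3 * X 1 ^ 7 := by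
      simp only [f, hD, map_add, map_mul, map_pow, hφq, h0, h1]
      ring
    have hmap : P.map φ ≤ Ideal.span {q} := by
      rw [Ideal.map_span, Ideal.span_le]
      rintro _ ⟨_, rfl | rfl, rfl⟩
      · simp [h0]
      · rw [hφq]
        exact Ideal.mem_span_singleton_self q
    have hdvd : q ^ 4 ∣ φ (s * f) := by
      rw [← Ideal.mem_span_singleton, ← Ideal.span_singleton_pow]
      apply Ideal.pow_right_mono hmap 4
      rw [← Ideal.map_pow]
      exact Ideal.mem_map_of_mem φ hsf
    have hX1q : ¬ (X 1 : MvPolynomial (Fin 4) k) ∣ q := by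
      intro h
      have h' := map_dvd (aeval (Function.update 1 1 0) : MvPolynomial (Fin 4) k →ₐ[k] k) h
      simp [hq] at h'
    have hq0 : q ≠ 0 := fun h => hX1q (h ▸ dvd_zero _)
    have hqs : q ∣ X 1 ^ 7 * φ s := by
      rw [map_mul, hφf, pow_succ, mul_left_comm, mul_comm (φ s)] at hdvd
      exact (mul_dvd_mul_iff_left (pow_ne_zero 3 hq0)).1 hdvd
    obtain ⟨g, hg⟩ := hqs
    obtain ⟨g', rfl⟩ : X 1 ^ 7 ∣ g :=
      X_prime.pow_dvd_of_dvd_mul_left 7 hX1q ⟨φ s, hg.symm⟩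
    have hφs : φ s = q * g' := by
      apply mul_left_cancel₀ (pow_ne_zero 7 (X_ne_zero (R := k) (1 : Fin 4)))
      rw [hg]; ring
    have hsub : s - φ s ∈ P := by
      obtain ⟨c, hc⟩ := X_dvd_sub_aeval_update_zero (0 : Fin 4) s
      rw [show s - φ s = X 0 * c from hc]
      exact P.mul_mem_right _ hX0
    rw [← sub_add_cancel s (φ s), hφs]
    exact add_mem (hφs ▸ hsub) (P.mul_mem_right _ hqP)
end

section
/- For t ≠ 0 the Cremona transformation g_t of degree 13 violates the Fano inequalities: for every point P ∈ P^3, min_i mult_P((f_t)_i) ≤ 6 < 13/2, and for every irreducible curve C ⊂ P^3, min_i mult_C((f_t)_i) ≤ 3 < 13/4. -/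
open MvPolynomial in
/-- The discriminant quartic as a polynomial in four variables. -/
noncomputable def Dpoly (k : Type*) [Field k] : MvPolynomial (Fin 4) k :=
  X 0 ^ 2 * X 3 ^ 2 - 3 * X 1 ^ 2 * X 2 ^ 2 - 6 * X 0 * X 1 * X 2 * X 3 +
    4 * X 0 * X 2 ^ 3 + 4 * X 3 * X 1 ^ 3

open MvPolynomial in
/-- The four degree-13 forms of the Cremona transformation `g_t` as polynomials. -/
noncomputable def ftPoly {k : Type*} [Field k] (t : k) : Fin 4 → MvPolynomial (Fin 4) k :=
  ![X 0 * Dpoly k ^ 3,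
    X 1 * Dpoly k ^ 3 + C t * X 0 ^ 5 * Dpoly k ^ 2,
    X 2 * Dpoly k ^ 3 + 2 * C t * X 1 * X 0 ^ 4 * Dpoly k ^ 2 + C t ^ 2 * X 0 ^ 9 * Dpoly k,
    X 3 * Dpoly k ^ 3 + 3 * C t * X 2 * X 0 ^ 4 * Dpoly k ^ 2 +
      3 * C t ^ 2 * X 1 * X 0 ^ 8 * Dpoly k + C t ^ 3 * X 0 ^ 13]

section Line

open Polynomial

variable {k K : Type*} [Field k] [Field K] [Algebra k K]

/-- Restriction of polynomials to the parametrised line `T ↦ x + T v`. -/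
noncomputable def lineHom (k : Type*) {K : Type*} [Field k] [Field K] [Algebra k K]
    (x v : Fin 4 → K) : MvPolynomial (Fin 4) k →ₐ[k] K[X] :=
  MvPolynomial.aeval fun j => C (x j) + C (v j) * X

@[simp]
lemma lineHom_X (x v : Fin 4 → K) (j : Fin 4) :
    lineHom k x v (MvPolynomial.X j) = C (x j) + C (v j) * X := by
  simp [lineHom]

@[simp]
lemma lineHom_C (x v : Fin 4 → K) (a : k) :
    lineHom k x v (MvPolynomial.C a) = C (algebraMap k K a) := by
  simp [lineHom]

lemma eval_zero_lineHom (x v : Fin 4 → K) (f : MvPolynomial (Fin 4) k) :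
    (lineHom k x v f).eval 0 = MvPolynomial.aeval x f := by
  have h : ((aeval (0 : K)).restrictScalars k).comp (lineHom k x v) = MvPolynomial.aeval x := by
    ext j
    simp
  simpa [coe_aeval_eq_eval] using DFunLike.congr_fun h f

lemma X_dvd_lineHom_iff (x v : Fin 4 → K) (f : MvPolynomial (Fin 4) k) :
    X ∣ lineHom k x v f ↔ MvPolynomial.aeval x f = 0 := by
  rw [X_dvd_iff, coeff_zero_eq_eval_zero, eval_zero_lineHom]

lemma X_pow_dvd_lineHom {I : Ideal (MvPolynomial (Fin 4) k)} {x : Fin 4 → K}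
    (hI : ∀ f ∈ I, MvPolynomial.aeval x f = 0) (v : Fin 4 → K) {n : ℕ}
    {f : MvPolynomial (Fin 4) k} (hf : f ∈ I ^ n) : X ^ n ∣ lineHom k x v f := by
  have hle : I ≤ (Ideal.span {X}).comap (lineHom k x v) := fun g hg =>
    Ideal.mem_span_singleton.2 ((X_dvd_lineHom_iff x v g).2 (hI g hg))
  have h := Ideal.le_comap_pow (lineHom k x v) n (Ideal.pow_right_mono hle n hf)
  rwa [Ideal.mem_comap, Ideal.span_singleton_pow, Ideal.mem_span_singleton] at h

lemma X_pow_dvd_lineHom_of_mul {I : Ideal (MvPolynomial (Fin 4) k)} {x : Fin 4 → K}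
    (hI : ∀ f, f ∈ I ↔ MvPolynomial.aeval x f = 0) (v : Fin 4 → K) {n : ℕ}
    {s f : MvPolynomial (Fin 4) k} (hs : s ∉ I) (hf : s * f ∈ I ^ n) :
    X ^ n ∣ lineHom k x v f := by
  have h := X_pow_dvd_lineHom (fun g hg => (hI g).1 hg) v hf
  rw [map_mul] at h
  refine Polynomial.prime_X.pow_dvd_of_dvd_mul_left n ?_ h
  rwa [X_dvd_lineHom_iff, ← hI]

/-- Through a point of the plane `x₀ = 0` off the point `(0 : 0 : 0 : 1)` there is a line,
transverse to the plane, along which the discriminant vanishes to order at most one. -/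
lemma exists_not_X_sq_dvd_lineHom_Dpoly [CharZero K] (x : Fin 4 → K) (h0 : x 0 = 0)
    (h : x 1 ≠ 0 ∨ x 2 ≠ 0) :
    ∃ s : K, ¬ X ^ 2 ∣ lineHom k x ![1, 0, 0, s] (Dpoly k) := by
  have key (s : K) (hs : X ^ 2 ∣ lineHom k x ![1, 0, 0, s] (Dpoly k)) :
      4 * x 2 ^ 3 - 6 * x 1 * x 2 * x 3 + 4 * s * x 1 ^ 3 = 0 := by
    obtain ⟨q, hq⟩ := hs
    have h' := congrArg (fun p => p.derivative.eval 0) hq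
    simp [Dpoly, h0, derivative_pow, map_ofNat] at h'
    linear_combination h'
  by_cases h1 : x 1 = 0
  · refine ⟨0, fun hs => ?_⟩
    simpa [h1, h.resolve_left (not_not.2 h1)] using key 0 hs
  · refine ⟨(1 - 4 * x 2 ^ 3 + 6 * x 1 * x 2 * x 3) / (4 * x 1 ^ 3), fun hs => ?_⟩
    have h' := key _ hs
    field_simp at h'
    ring_nf at h'
    simp at h'

end Line

section Curve

open MvPolynomial

lemma ringKrullDim_quotient_le_one {k : Type*} [Field k] {σ : Type*}
    (P : Ideal (MvPolynomial σ k)) (i : σ) (h : ∀ j ≠ i, X j ∈ P) :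
    ringKrullDim (MvPolynomial σ k ⧸ P) ≤ 1 := by
  let φ : Polynomial k →ₐ[k] MvPolynomial σ k ⧸ P :=
    Polynomial.aeval (Ideal.Quotient.mk P (X i))
  have hφ : Function.Surjective φ := by
    intro y
    obtain ⟨f, rfl⟩ := Ideal.Quotient.mk_surjective y
    induction f using MvPolynomial.induction_on with
    | C a => exact ⟨Polynomial.C a, by simp [φ]; rfl⟩
    | add p q hp hq =>
      obtain ⟨a, ha⟩ := hp
      obtain ⟨b, hb⟩ := hq
      exact ⟨a + b, by simp [ha, hb]⟩
    | mul_X p j hp =>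
      obtain ⟨a, ha⟩ := hp
      by_cases hj : j = i
      · subst hj
        exact ⟨a * Polynomial.X, by rw [map_mul, ha, map_mul]; simp [φ]⟩
      · exact ⟨0, by simp [Ideal.Quotient.eq_zero_iff_mem.2 (h j hj)]⟩
  refine (ringKrullDim_le_of_surjective φ.toRingHom hφ).trans ?_
  rw [Polynomial.ringKrullDim_of_isNoetherianRing, ringKrullDim_eq_zero_of_field]
  simp

lemma not_forall_X_mem {k : Type*} [Field k] {σ : Type*} {P : Ideal (MvPolynomial σ k)}
    (hdim : ringKrullDim (MvPolynomial σ k ⧸ P) = 2) (i : σ) : ¬ ∀ j ≠ i, X j ∈ P := by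
  intro h
  have := ringKrullDim_quotient_le_one P i h
  rw [hdim] at this
  exact absurd this (by decide)

lemma X_zero_mem_and_Dpoly_mem {k : Type*} [Field k] {t : k} (ht : t ≠ 0)
    {P : Ideal (MvPolynomial (Fin 4) k)} (hP : P.IsPrime)
    (hdim : ringKrullDim (MvPolynomial (Fin 4) k ⧸ P) = 2) (hf : ∀ i, ftPoly t i ∈ P) :
    X 0 ∈ P ∧ Dpoly k ∈ P := by
  have hf0 : X 0 * Dpoly k ^ 3 ∈ P := hf 0
  have hf1 : X 1 * Dpoly k ^ 3 + C t * X 0 ^ 5 * Dpoly k ^ 2 ∈ P := hf 1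
  have hf2 : X 2 * Dpoly k ^ 3 + 2 * C t * X 1 * X 0 ^ 4 * Dpoly k ^ 2 +
    C t ^ 2 * X 0 ^ 9 * Dpoly k ∈ P := hf 2
  have hf3 : X 3 * Dpoly k ^ 3 + 3 * C t * X 2 * X 0 ^ 4 * Dpoly k ^ 2 +
      3 * C t ^ 2 * X 1 * X 0 ^ 8 * Dpoly k + C t ^ 3 * X 0 ^ 13 ∈ P := hf 3
  have hCt : C t ∉ P := fun h =>
    hP.ne_top (P.eq_top_of_isUnit_mem h ((isUnit_iff_ne_zero.2 ht).map C))
  have hX : X 0 ∈ P := by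
    refine (hP.mem_or_mem hf0).elim id fun hD => ?_
    have hD := hP.mem_of_pow_mem 3 hD
    rw [← Ideal.Quotient.eq_zero_iff_mem] at hD hf3 hCt ⊢
    simpa [hD, hCt] using hf3
  refine ⟨hX, ?_⟩
  by_contra hD
  refine not_forall_X_mem hdim 0 fun j hj => ?_
  rw [← Ideal.Quotient.eq_zero_iff_mem] at hX hD hf1 hf2 hf3 ⊢
  fin_cases j
  · exact absurd rfl hj
  · simpa [hX, hD] using hf1
  · simpa [hX, hD] using hf2
  · simpa [hX, hD] using hf3

lemma X_two_notMem {k : Type*} [Field k] [CharZero k]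
    {P : Ideal (MvPolynomial (Fin 4) k)} (hP : P.IsPrime)
    (hdim : ringKrullDim (MvPolynomial (Fin 4) k ⧸ P) = 2) (hX : X 0 ∈ P)
    (hD : Dpoly k ∈ P) : X 2 ∉ P := by
  intro h2
  have h4 : (4 : MvPolynomial (Fin 4) k) ∉ P := fun h =>
    hP.ne_top (P.eq_top_of_isUnit_mem h (by
      have h4k : IsUnit (4 : k) := isUnit_iff_ne_zero.2 (by norm_num)
      simpa [map_ofNat] using h4k.map (C : k →+* MvPolynomial (Fin 4) k)))
  have h : X 3 ∈ P ∨ X 1 ∈ P := by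
    rw [← Ideal.Quotient.eq_zero_iff_mem] at hX hD h2 h4
    rw [← Ideal.Quotient.eq_zero_iff_mem, ← Ideal.Quotient.eq_zero_iff_mem]
    rw [map_ofNat] at h4
    simpa [Dpoly, hX, h2, h4, map_ofNat] using hD
  rcases h with h | h
  · refine not_forall_X_mem hdim 1 fun j hj => ?_
    fin_cases j
    exacts [hX, absurd rfl hj, h2, h]
  · refine not_forall_X_mem hdim 3 fun j hj => ?_
    fin_cases j
    exacts [hX, h, h2, absurd rfl hj]

lemma exists_ftPoly_notMem_symbolic_pow_four {k : Type*} [Field k] [CharZero k]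
    {t : k} (ht : t ≠ 0) {P : Ideal (MvPolynomial (Fin 4) k)} (hP : P.IsPrime)
    (hdim : ringKrullDim (MvPolynomial (Fin 4) k ⧸ P) = 2) :
    ∃ i : Fin 4, ¬ ∃ s ∉ P, s * ftPoly t i ∈ P ^ 4 := by
  by_contra! hall
  have hf (i : Fin 4) : ftPoly t i ∈ P := by
    obtain ⟨s, hs, h⟩ := hall i
    exact (hP.mem_or_mem (Ideal.pow_le_self four_ne_zero h)).resolve_left hs
  obtain ⟨hX, hD⟩ := X_zero_mem_and_Dpoly_mem ht hP hdim hf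
  have h2 := X_two_notMem hP hdim hX hD
  let K := FractionRing (MvPolynomial (Fin 4) k ⧸ P)
  have : CharZero K := charZero_of_injective_algebraMap (algebraMap k K).injective
  let x : Fin 4 → K := fun j =>
    algebraMap (MvPolynomial (Fin 4) k ⧸ P) K (Ideal.Quotient.mk P (X j))
  have hI (f : MvPolynomial (Fin 4) k) : f ∈ P ↔ aeval x f = 0 := by
    have hx : aeval x = (IsScalarTower.toAlgHom k (MvPolynomial (Fin 4) k ⧸ P) K).comp
        (Ideal.Quotient.mkₐ k P) := by
      ext j
      simp [x]
    rw [hx]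
    simp [Ideal.Quotient.eq_zero_iff_mem]
  have hx0 : x 0 = 0 := by simpa using (hI (X 0)).1 hX
  have hx2 : x 2 ≠ 0 := by simpa using (hI (X 2)).not.1 h2
  obtain ⟨c, hc⟩ := exists_not_X_sq_dvd_lineHom_Dpoly (k := k) x hx0 (.inr hx2)
  obtain ⟨s, hs, hsf⟩ := hall 2
  have hdvd := X_pow_dvd_lineHom_of_mul hI ![1, 0, 0, c] hs hsf
  obtain ⟨E, hE⟩ := (X_dvd_lineHom_iff x ![1, 0, 0, c] (Dpoly k)).2 ((hI _).1 hD)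
  rw [hE, sq, mul_dvd_mul_iff_left Polynomial.X_ne_zero, Polynomial.X_dvd_iff] at hc
  obtain ⟨q, hq⟩ := hdvd
  have hq' : Polynomial.X ^ 3 * (Polynomial.C (x 2) * E ^ 3) = Polynomial.X ^ 3 *
      (Polynomial.X * (q - 2 * Polynomial.C (algebraMap k K t) * Polynomial.C (x 1) *
        Polynomial.X ^ 2 * E ^ 2 -
        Polynomial.C (algebraMap k K t) ^ 2 * Polynomial.X ^ 6 * E)) := by
    simp [ftPoly, hE, hx0, map_ofNat] at hq
    linear_combination hq
  have h0 := congrArg (Polynomial.coeff · 0)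
    (mul_left_cancel₀ (pow_ne_zero 3 Polynomial.X_ne_zero) hq')
  simp [Polynomial.coeff_zero_eq_eval_zero] at h0
  rw [Polynomial.coeff_zero_eq_eval_zero] at hc
  exact h0.elim hx2 hc

lemma exists_ftPoly_notMem_pow_seven {k : Type*} [Field k] [CharZero k]
    {t : k} (ht : t ≠ 0) {x : Fin 4 → k} (hx : x ≠ 0) :
    ∃ i : Fin 4, ftPoly t i ∉
      (Ideal.span (Set.range fun j : Fin 4 => X j - C (x j)) :
        Ideal (MvPolynomial (Fin 4) k)) ^ 7 := by
  by_contra! hall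
  have hI : ∀ f ∈ Ideal.span (Set.range fun j : Fin 4 => X j - C (x j)), aeval x f = 0 := by
    intro f hf
    rw [← RingHom.mem_ker]
    refine (Ideal.span_le.2 ?_ : _ ≤ RingHom.ker (aeval x)) hf
    rintro _ ⟨j, rfl⟩
    simp [RingHom.mem_ker]
  have hdvd (v : Fin 4 → k) (i : Fin 4) := X_pow_dvd_lineHom hI v (hall i)
  have hx0 : x 0 = 0 := by
    have heval (i : Fin 4) : aeval x (ftPoly t i) = 0 :=
      hI _ (Ideal.pow_le_self (by norm_num) (hall i))
    by_contra h0
    have hD : eval x (Dpoly k) = 0 := by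
      have h : aeval x (X 0 * Dpoly k ^ 3) = 0 := heval 0
      simpa [h0] using h
    have h : aeval x (X 3 * Dpoly k ^ 3 + 3 * C t * X 2 * X 0 ^ 4 * Dpoly k ^ 2 +
      3 * C t ^ 2 * X 1 * X 0 ^ 8 * Dpoly k + C t ^ 3 * X 0 ^ 13) = 0 := heval 3
    simp [hD, h0, ht] at h
  by_cases h : x 1 ≠ 0 ∨ x 2 ≠ 0
  · obtain ⟨s, hs⟩ := exists_not_X_sq_dvd_lineHom_Dpoly (k := k) x hx0 h
    have h0 : Polynomial.X ^ 7 ∣ lineHom k x ![1, 0, 0, s] (X 0 * Dpoly k ^ 3) :=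
      hdvd ![1, 0, 0, s] 0
    rw [map_mul, map_pow, lineHom_X, pow_succ'] at h0
    simp only [hx0, map_zero, Matrix.cons_val_zero, map_one, one_mul, zero_add] at h0
    rw [mul_dvd_mul_iff_left Polynomial.X_ne_zero, pow_mul _ 2 3,
      IsIntegrallyClosed.pow_dvd_pow_iff three_ne_zero] at h0
    exact hs h0
  · push Not at h
    have hx3 : x 3 ≠ 0 := fun h3 => hx (by
      ext j
      fin_cases j
      exacts [hx0, h.1, h.2, h3])
    obtain ⟨q, hq⟩ := hdvd ![1, 0, 0, 0] 3
    have hq' : Polynomial.X ^ 6 * Polynomial.C (x 3) ^ 7 = Polynomial.X ^ 6 *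
        (Polynomial.X * (q - Polynomial.C t ^ 3 * Polynomial.X ^ 6)) := by
      simp [ftPoly, Dpoly, hx0, h.1, h.2] at hq
      linear_combination hq
    have h0 := congrArg (Polynomial.eval 0)
      (mul_left_cancel₀ (pow_ne_zero 6 Polynomial.X_ne_zero) hq')
    simp [hx3] at h0

end Curve

open MvPolynomial in
/-- For `t ≠ 0` the degree-13 Cremona transformation `g_t` violates the Fano
inequalities: at every point `P` of `P^3` some form `(f_t)_i` has multiplicity at most
`6 < 13/2` (it is not in the 7th power of the maximal ideal of `P`), and along every
irreducible curve `C` (a homogeneous prime ideal whose cone has Krull dimension `2`)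
some form has multiplicity at most `3 < 13/4` (it is not in the 4th symbolic power). -/
theorem fano_inequality_fails {k : Type*} [Field k] [IsAlgClosed k] [CharZero k]
    (t : k) (ht : t ≠ 0) :
    (∀ x : Fin 4 → k, x ≠ 0 →
      ∃ i : Fin 4,
        ftPoly t i ∉
          (Ideal.span (Set.range fun j : Fin 4 => X j - C (x j)) :
            Ideal (MvPolynomial (Fin 4) k)) ^ 7) ∧
    ((6 : ℚ) < 13 / 2) ∧
    (∀ P : Ideal (MvPolynomial (Fin 4) k), P.IsPrime →
      (∀ f ∈ P, ∀ n : ℕ, homogeneousComponent n f ∈ P) →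
      ringKrullDim (MvPolynomial (Fin 4) k ⧸ P) = 2 →
      ∃ i : Fin 4, ¬ ∃ s ∉ P, s * ftPoly t i ∈ P ^ 4) ∧
    ((3 : ℚ) < 13 / 4) :=
  ⟨fun _ hx => exists_ftPoly_notMem_pow_seven ht hx, by norm_num,
    fun _ hP _ hdim => exists_ftPoly_notMem_symbolic_pow_four ht hP hdim, by norm_num⟩
end
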